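/- Let n ≥ 1, 1 < p < ∞, and 0 < α < n/p. Then there is a constant C such that for all f ∈ C_c^∞(ℝⁿ), ‖ |x|^{-α} f ‖_p ≤ C ‖ (-Δ)^{α/2} f ‖_p. -/

import Mathlib

open MeasureTheory
open scoped FourierTransform ENNReal

/-- **Schur test** in `L^p` for a nonnegative kernel with a single weight. -/
theorem lintegral_rpow_lintegral_mul_le_of_schur {X : Type*} [MeasurableSpace X] {μ : Measure X}
    [SFinite μ] {p q : ℝ} (hpq : p.HolderConjugate q) {K : X → X → ℝ≥0∞}
    (hK : Measurable (Function.uncurry K)) {w G : X → ℝ≥0∞} (hw : Measurable w)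
    (hG : Measurable G) (hw0 : ∀ᵐ x ∂μ, w x ≠ 0) (hwt : ∀ᵐ x ∂μ, w x ≠ ∞) {A B : ℝ≥0∞}
    (hA : ∀ᵐ x ∂μ, ∫⁻ y, K x y * w y ^ q ∂μ ≤ A * w x ^ q)
    (hB : ∀ᵐ y ∂μ, ∫⁻ x, K x y * w x ^ p ∂μ ≤ B * w y ^ p) :
    ∫⁻ x, (∫⁻ y, K x y * G y ∂μ) ^ p ∂μ ≤ A ^ (p / q) * B * ∫⁻ y, G y ^ p ∂μ := by
  have hp := hpq.pos
  have hq := hpq.symm.pos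
  have hKx (x : X) : Measurable (K x) := hK.comp measurable_prodMk_left
  have hKy (y : X) : Measurable fun x => K x y := hK.comp measurable_prodMk_right
  have holder : ∀ᵐ x ∂μ, (∫⁻ y, K x y * G y ∂μ) ^ p
      ≤ A ^ (p / q) * (w x ^ p * ∫⁻ y, K x y * (G y / w y) ^ p ∂μ) := by
    filter_upwards [hA] with x hx
    have split : ∫⁻ y, K x y * G y ∂μ
        = ∫⁻ y, (K x y ^ (1 / q) * w y) * (K x y ^ (1 / p) * (G y / w y)) ∂μ := by
      refine lintegral_congr_ae ?_
      filter_upwards [hw0, hwt] with y h0 ht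
      calc K x y * G y = K x y ^ (1 / q + 1 / p) * G y := by
            rw [one_div, one_div, add_comm, hpq.inv_add_inv_eq_one, ENNReal.rpow_one]
        _ = K x y ^ (1 / q) * K x y ^ (1 / p) * (w y * (G y / w y)) := by
            rw [ENNReal.rpow_add_of_nonneg _ _ (by positivity) (by positivity),
              ENNReal.mul_div_cancel h0 ht]
        _ = _ := by ring
    have key := ENNReal.lintegral_mul_le_Lp_mul_Lq μ hpq.symm
      (f := fun y => K x y ^ (1 / q) * w y) (g := fun y => K x y ^ (1 / p) * (G y / w y))
      (by have := hKx x; fun_prop) (by have := hKx x; fun_prop)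
    simp only [Pi.mul_apply, ENNReal.mul_rpow_of_nonneg _ _ hp.le,
      ENNReal.mul_rpow_of_nonneg _ _ hq.le, ← ENNReal.rpow_mul, one_div_mul_cancel hp.ne',
      one_div_mul_cancel hq.ne', ENNReal.rpow_one] at key
    rw [split]
    calc _ ≤ ((A * w x ^ q) ^ (1 / q) * (∫⁻ y, K x y * (G y / w y) ^ p ∂μ) ^ (1 / p)) ^ p := by
            gcongr
            exact key.trans (by gcongr)
      _ = _ := by
            rw [ENNReal.mul_rpow_of_nonneg _ _ hp.le, ← ENNReal.rpow_mul, ← ENNReal.rpow_mul,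
              one_div_mul_cancel hp.ne', ENNReal.rpow_one,
              ENNReal.mul_rpow_of_nonneg _ _ (by positivity), ← ENNReal.rpow_mul]
            rw [show 1 / q * p = p / q by ring, show q * (p / q) = p by field_simp, mul_assoc]
  calc _ ≤ ∫⁻ x, A ^ (p / q) * (w x ^ p * ∫⁻ y, K x y * (G y / w y) ^ p ∂μ) ∂μ :=
        lintegral_mono_ae holder
    _ = A ^ (p / q) * ∫⁻ x, ∫⁻ y, w x ^ p * (K x y * (G y / w y) ^ p) ∂μ ∂μ := by
        rw [lintegral_const_mul]
        · congr 1
          refine lintegral_congr fun x => ?_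
          rw [lintegral_const_mul _ (by have := hKx x; fun_prop)]
        · refine (hw.pow_const p).mul (Measurable.lintegral_prod_right' (f := fun z : X × X =>
            K z.1 z.2 * (G z.2 / w z.2) ^ p) ?_)
          exact hK.mul (by fun_prop)
    _ = A ^ (p / q) * ∫⁻ y, ∫⁻ x, (K x y * w x ^ p) * (G y / w y) ^ p ∂μ ∂μ := by
        rw [lintegral_lintegral_swap]
        · congr! 5; ring
        · exact (Measurable.mul (by fun_prop) (hK.mul (by fun_prop))).aemeasurable
    _ = A ^ (p / q) * ∫⁻ y, (∫⁻ x, K x y * w x ^ p ∂μ) * (G y / w y) ^ p ∂μ := by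
        congr 1
        refine lintegral_congr fun y => ?_
        rw [lintegral_mul_const _ (by have := hKy y; fun_prop)]
    _ ≤ A ^ (p / q) * ∫⁻ y, B * G y ^ p ∂μ := by
        gcongr 1
        refine lintegral_mono_ae ?_
        filter_upwards [hB, hw0, hwt] with y hy h0 ht
        calc _ ≤ B * w y ^ p * (G y / w y) ^ p := by gcongr
          _ = _ := by
            rw [mul_assoc, ← ENNReal.mul_rpow_of_nonneg _ _ hp.le, ENNReal.mul_div_cancel h0 ht]
    _ = _ := by rw [lintegral_const_mul _ (by fun_prop), mul_assoc]

section Radial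

variable {E : Type*} [NormedAddCommGroup E] [InnerProductSpace ℝ E] [FiniteDimensional ℝ E]
  [MeasurableSpace E] [BorelSpace E]

/-- Homogeneity of the integral of `‖x‖ ^ c` over radial sets. -/
theorem setLIntegral_norm_rpow_scale {T : Set ℝ} (hT : MeasurableSet T) {R : ℝ} (hR : 0 < R)
    (c : ℝ) :
    ∫⁻ x in {x : E | ‖x‖ / R ∈ T}, ENNReal.ofReal (‖x‖ ^ c)
      = ENNReal.ofReal (R ^ (Module.finrank ℝ E + c))
        * ∫⁻ x in {x : E | ‖x‖ ∈ T}, ENNReal.ofReal (‖x‖ ^ c) := by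
  have hT' : MeasurableSet {x : E | ‖x‖ ∈ T} := measurable_norm hT
  have hTR : MeasurableSet {x : E | ‖x‖ / R ∈ T} := (measurable_norm.div_const R) hT
  have hmap := Measure.map_addHaar_smul (volume : Measure E) hR.ne'
  have hvol : (volume : Measure E) = ENNReal.ofReal (R ^ (Module.finrank ℝ E)) •
      Measure.map (R • ·) (volume : Measure E) := by
    rw [hmap, smul_smul, ← ENNReal.ofReal_mul (by positivity), abs_of_pos (by positivity),
      mul_inv_cancel₀ (by positivity), ENNReal.ofReal_one, one_smul]
  rw [← lintegral_indicator hTR, ← lintegral_indicator hT']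
  conv_lhs => rw [hvol]
  rw [lintegral_smul_measure, lintegral_map ((by fun_prop : Measurable fun x : E =>
    ENNReal.ofReal (‖x‖ ^ c)).indicator hTR) (by fun_prop), Real.rpow_add hR, Real.rpow_natCast,
    ENNReal.ofReal_mul (by positivity), mul_assoc, smul_eq_mul, ← lintegral_const_mul (ENNReal.ofReal (R ^ c))]
  · congr 1
    refine lintegral_congr fun x => ?_
    have : ‖R • x‖ = R * ‖x‖ := by rw [norm_smul, Real.norm_of_nonneg hR.le]
    by_cases h : ‖x‖ ∈ T
    · rw [Set.indicator_of_mem, Set.indicator_of_mem (by exact h), this,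
        Real.mul_rpow hR.le (norm_nonneg _), ENNReal.ofReal_mul (by positivity)]
      simpa [this, hR.ne'] using h
    · rw [Set.indicator_of_notMem, Set.indicator_of_notMem (by exact h), mul_zero]
      simpa [this, hR.ne'] using h
  · exact (by fun_prop : Measurable fun x : E => ENNReal.ofReal (‖x‖ ^ c)).indicator hT'

theorem setLIntegral_norm_lt_one_rpow_lt_top [Nontrivial E] {c : ℝ}
    (hc : -(Module.finrank ℝ E : ℝ) < c) :
    ∫⁻ x in {x : E | ‖x‖ ∈ Set.Iio 1}, ENNReal.ofReal (‖x‖ ^ c) < ∞ := by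
  have : IntegrableOn (fun x : E => ‖x‖ ^ c) (Metric.ball 0 1) :=
    integrableOn_ball_of_norm_le_rpow (C := 1) (α := -c) Module.finrank_pos (by linarith)
      (.of_forall fun x => by simp [Real.norm_of_nonneg (Real.rpow_nonneg (norm_nonneg x) c)])
      (by fun_prop : Measurable fun x : E => ‖x‖ ^ c).aestronglyMeasurable
  have h := this.lintegral_lt_top
  have hs : {x : E | ‖x‖ ∈ Set.Iio 1} = Metric.ball 0 1 := by ext; simp
  rwa [hs]

theorem setLIntegral_one_le_norm_rpow_lt_top {c : ℝ} (hc : c < -(Module.finrank ℝ E : ℝ)) :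
    ∫⁻ x in {x : E | ‖x‖ ∈ Set.Ici 1}, ENNReal.ofReal (‖x‖ ^ c) < ∞ := by
  have hi := ((integrable_one_add_norm (μ := (volume : Measure E)) (r := -c)
    (by linarith)).const_mul ((2 : ℝ) ^ (-c))).lintegral_lt_top
  refine lt_of_le_of_lt ?_ hi
  refine (setLIntegral_mono' (measurable_norm measurableSet_Ici) fun x hx => ?_).trans
    (setLIntegral_le_lintegral _ _)
  have hx : 1 ≤ ‖x‖ := hx
  have hc' : c ≤ 0 := hc.le.trans (by simp)
  apply ENNReal.ofReal_le_ofReal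
  rw [neg_neg, Real.rpow_neg (by norm_num), ← Real.inv_rpow (by norm_num),
    ← Real.mul_rpow (by norm_num) (by positivity)]
  exact Real.rpow_le_rpow_of_nonpos (by positivity) (by linarith) hc'

/-- The Riesz potential of order `α` of `‖y‖ ^ (-b)` is dominated by `‖x‖ ^ (α - b)`. -/
theorem exists_lintegral_riesz_mul_norm_rpow_le [Nontrivial E] {α b : ℝ} (hα : 0 < α)
    (hαb : α < b) (hb : b < Module.finrank ℝ E) :
    ∃ A : ℝ≥0∞, A ≠ ∞ ∧ ∀ x : E, x ≠ 0 →
      ∫⁻ y, ENNReal.ofReal (‖x - y‖ ^ (α - Module.finrank ℝ E)) * ENNReal.ofReal (‖y‖ ^ (-b))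
        ≤ A * ENNReal.ofReal (‖x‖ ^ (α - b)) := by
  set d : ℝ := (Module.finrank ℝ E : ℝ) with hd
  set I₁ := ∫⁻ x in {x : E | ‖x‖ ∈ Set.Iio 1}, ENNReal.ofReal (‖x‖ ^ (-b)) with hI₁
  set I₂ := ∫⁻ x in {x : E | ‖x‖ ∈ Set.Iio 1}, ENNReal.ofReal (‖x‖ ^ (α - d)) with hI₂
  set I₃ := ∫⁻ x in {x : E | ‖x‖ ∈ Set.Ici 1}, ENNReal.ofReal (‖x‖ ^ (α - d - b)) with hI₃
  have h₁ : I₁ < ∞ := setLIntegral_norm_lt_one_rpow_lt_top (by linarith)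
  have h₂ : I₂ < ∞ := setLIntegral_norm_lt_one_rpow_lt_top (by linarith)
  have h₃ : I₃ < ∞ := setLIntegral_one_le_norm_rpow_lt_top (by linarith)
  set κ := ENNReal.ofReal ((3 : ℝ) ^ (d - α)) with hκ
  refine ⟨(I₁ + I₂ + κ * I₃) * ENNReal.ofReal ((1 / 2 : ℝ) ^ (α - b)), ?_, fun x hx => ?_⟩
  · exact ENNReal.mul_ne_top (by simp [h₁.ne, h₂.ne, ENNReal.mul_ne_top, h₃.ne, hκ])
      ENNReal.ofReal_ne_top
  have hx' : 0 < ‖x‖ := norm_pos_iff.mpr hx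
  set R := ‖x‖ / 2 with hR
  have hR0 : 0 < R := by positivity
  set F : E → ℝ≥0∞ := fun y =>
    ENNReal.ofReal (‖x - y‖ ^ (α - d)) * ENNReal.ofReal (‖y‖ ^ (-b)) with hF
  have hRpow : ENNReal.ofReal ((1 / 2 : ℝ) ^ (α - b)) * ENNReal.ofReal (‖x‖ ^ (α - b))
      = ENNReal.ofReal (R ^ (α - b)) := by
    rw [← ENNReal.ofReal_mul (by positivity), ← Real.mul_rpow (by positivity) (by positivity)]
    congr 2; ring
  have near : ∫⁻ y in {y : E | ‖y‖ / R ∈ Set.Iio 1}, F y ≤ I₁ * ENNReal.ofReal (R ^ (α - b)) := by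
    calc _ ≤ ∫⁻ y in {y : E | ‖y‖ / R ∈ Set.Iio 1},
          ENNReal.ofReal (R ^ (α - d)) * ENNReal.ofReal (‖y‖ ^ (-b)) := by
          refine setLIntegral_mono' (measurable_norm.div_const R measurableSet_Iio) fun y hy => ?_
          have hy : ‖y‖ < R := by simpa [div_lt_one hR0] using hy
          have := norm_sub_norm_le x y
          gcongr ENNReal.ofReal ?_ * _
          exact Real.rpow_le_rpow_of_nonpos hR0 (by linarith) (by linarith)
      _ = _ := by
          rw [lintegral_const_mul _ (by fun_prop), setLIntegral_norm_rpow_scale measurableSet_Iio hR0,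
            ← hI₁, ← mul_assoc, ← ENNReal.ofReal_mul (by positivity), ← Real.rpow_add hR0, mul_comm]
          congr 3; ring
  have diag : ∫⁻ y in {y : E | ‖x - y‖ / R ∈ Set.Iio 1}, F y
      ≤ I₂ * ENNReal.ofReal (R ^ (α - b)) := by
    have hm : MeasurableSet {y : E | ‖y‖ / R ∈ Set.Iio 1} :=
      measurable_norm.div_const R measurableSet_Iio
    calc _ ≤ ∫⁻ y in {y : E | ‖x - y‖ / R ∈ Set.Iio 1},
          ENNReal.ofReal (‖x - y‖ ^ (α - d)) * ENNReal.ofReal (R ^ (-b)) := by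
          refine setLIntegral_mono' ((by fun_prop : Measurable fun y : E => ‖x - y‖ / R)
            measurableSet_Iio) fun y hy => ?_
          have hy : ‖x - y‖ < R := by simpa [div_lt_one hR0] using hy
          have := norm_sub_norm_le x (x - y)
          rw [sub_sub_cancel] at this
          gcongr _ * ENNReal.ofReal ?_
          exact Real.rpow_le_rpow_of_nonpos hR0 (by linarith) (by linarith)
      _ = (∫⁻ y in {y : E | ‖y‖ / R ∈ Set.Iio 1}, ENNReal.ofReal (‖y‖ ^ (α - d)))
            * ENNReal.ofReal (R ^ (-b)) := by
          rw [lintegral_mul_const _ (by fun_prop), ← lintegral_indicator hm,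
            ← lintegral_sub_left_eq_self ({y : E | ‖y‖ / R ∈ Set.Iio 1}.indicator _) x,
            ← lintegral_indicator]
          · rfl
          · exact (by fun_prop : Measurable fun y : E => ‖x - y‖ / R) measurableSet_Iio
      _ = _ := by
          rw [setLIntegral_norm_rpow_scale measurableSet_Iio hR0, ← hI₂, mul_right_comm,
            ← ENNReal.ofReal_mul (by positivity), ← Real.rpow_add hR0, mul_comm]
          congr 3; ring
  have far : ∫⁻ y in {y : E | ‖y‖ / R ∈ Set.Ici 1} ∩ {y : E | ‖x - y‖ / R ∈ Set.Ici 1}, F y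
      ≤ κ * I₃ * ENNReal.ofReal (R ^ (α - b)) := by
    have hm : MeasurableSet {y : E | ‖y‖ / R ∈ Set.Ici 1} :=
      measurable_norm.div_const R measurableSet_Ici
    have hm' : MeasurableSet {y : E | ‖x - y‖ / R ∈ Set.Ici 1} :=
      (by fun_prop : Measurable fun y : E => ‖x - y‖ / R) measurableSet_Ici
    calc _ ≤ ∫⁻ y in {y : E | ‖y‖ / R ∈ Set.Ici 1} ∩ {y : E | ‖x - y‖ / R ∈ Set.Ici 1},
          κ * ENNReal.ofReal (‖y‖ ^ (α - d - b)) := by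
          refine setLIntegral_mono' (hm.inter hm') fun y hy => ?_
          have hy₁ : R ≤ ‖y‖ := by simpa [one_le_div hR0] using hy.1
          have hy₂ : R ≤ ‖x - y‖ := by simpa [one_le_div hR0] using hy.2
          have hy₀ : 0 < ‖y‖ := hR0.trans_le hy₁
          have := norm_sub_norm_le y (y - x)
          rw [sub_sub_cancel, norm_sub_rev y x] at this
          simp only [hF, hκ]
          rw [← ENNReal.ofReal_mul (by positivity), ← ENNReal.ofReal_mul (by positivity)]
          apply ENNReal.ofReal_le_ofReal
          rw [sub_eq_add_neg (α - d) b, Real.rpow_add hy₀, ← mul_assoc]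
          gcongr
          rw [← neg_sub α d, Real.rpow_neg (by norm_num), ← Real.inv_rpow (by norm_num),
            ← Real.mul_rpow (by norm_num) (by positivity)]
          exact Real.rpow_le_rpow_of_nonpos (by positivity) (by linarith) (by linarith)
      _ ≤ ∫⁻ y in {y : E | ‖y‖ / R ∈ Set.Ici 1}, κ * ENNReal.ofReal (‖y‖ ^ (α - d - b)) :=
          lintegral_mono_set Set.inter_subset_left
      _ = _ := by
          rw [lintegral_const_mul _ (by fun_prop), setLIntegral_norm_rpow_scale measurableSet_Ici hR0,
            ← hI₃, mul_comm (ENNReal.ofReal (R ^ _)), mul_assoc]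
          congr 4; ring
  have cover : (Set.univ : Set E) ⊆ ({y | ‖y‖ / R ∈ Set.Iio 1} ∪ {y | ‖x - y‖ / R ∈ Set.Iio 1})
      ∪ ({y | ‖y‖ / R ∈ Set.Ici 1} ∩ {y | ‖x - y‖ / R ∈ Set.Ici 1}) := by
    intro y _
    simp only [Set.mem_union, Set.mem_inter_iff, Set.mem_ofPred_eq, Set.mem_Iio, Set.mem_Ici]
    grind
  calc ∫⁻ y, F y = ∫⁻ y in Set.univ, F y := by rw [setLIntegral_univ]
    _ ≤ _ := lintegral_mono_set cover
    _ ≤ _ := (lintegral_union_le _ _ _).trans (add_le_add_left (lintegral_union_le _ _ _) _)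
    _ ≤ _ := add_le_add (add_le_add near diag) far
    _ = _ := by rw [← add_mul, ← add_mul, mul_assoc, hRpow]

end Radial

theorem lintegral_rpow_mul_exp_neg_div_Ioi {a r : ℝ} (ha : 0 < a) (hr : 0 < r) :
    ∫⁻ t in Set.Ioi (0 : ℝ), ENNReal.ofReal (t ^ (-a - 1) * Real.exp (-(r / t)))
      = ENNReal.ofReal ((1 / r) ^ a * Real.Gamma a) := by
  have hI : ∫ t in Set.Ioi (0 : ℝ), t ^ (-a - 1) * Real.exp (-(r / t))
      = (1 / r) ^ a * Real.Gamma a := by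
    rw [← Real.integral_rpow_mul_exp_neg_mul_Ioi ha hr,
      ← integral_comp_rpow_Ioi (fun t : ℝ => t ^ (a - 1) * Real.exp (-(r * t)))
        (by norm_num : (-1 : ℝ) ≠ 0)]
    refine setIntegral_congr_fun measurableSet_Ioi fun t ht => ?_
    have ht : 0 < t := ht
    simp only [smul_eq_mul]
    rw [← Real.rpow_mul ht.le, ← mul_assoc, abs_neg, abs_one, one_mul, ← Real.rpow_add ht,
      Real.rpow_neg_one, div_eq_mul_inv]
    congr 2
    ring
  rw [← hI, ofReal_integral_eq_lintegral_ofReal]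
  · refine not_imp_comm.1 integral_undef ?_
    rw [hI]
    positivity
  · filter_upwards [ae_restrict_mem measurableSet_Ioi] with t ht
    have : 0 < t := ht
    simp only [Pi.zero_apply]
    positivity

section Riesz

variable {E : Type*} [NormedAddCommGroup E] [InnerProductSpace ℝ E] [FiniteDimensional ℝ E]
  [MeasurableSpace E] [BorelSpace E]

/-- The heat flow of `g`, written on the Fourier side, is bounded by the Gaussian average of `‖g‖`. -/
theorem enorm_integral_gaussian_mul_fourier_le {g : E → ℂ} (hg : Integrable g) {t : ℝ}
    (ht : 0 < t) (x : E) :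
    ‖∫ ξ, Complex.exp (-t * ‖ξ‖ ^ 2 + 2 * Real.pi * Complex.I * inner ℝ x ξ) * 𝓕 g ξ‖ₑ
      ≤ ∫⁻ y, ENNReal.ofReal ((Real.pi / t) ^ (Module.finrank ℝ E / 2 : ℝ)
          * Real.exp (-(Real.pi ^ 2 * ‖x - y‖ ^ 2 / t))) * ‖g y‖ₑ := by
  have ht' : 0 < (t : ℂ).re := by simpa
  have hJ : Integrable fun ξ : E =>
      Complex.exp (-t * ‖ξ‖ ^ 2 + 2 * Real.pi * Complex.I * inner ℝ x ξ) :=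
    GaussianFourier.integrable_cexp_neg_mul_sq_norm_add ht' _ _
  have hflip : ∫ ξ, Complex.exp (-t * ‖ξ‖ ^ 2 + 2 * Real.pi * Complex.I * inner ℝ x ξ) * 𝓕 g ξ
      = ∫ y, 𝓕 (fun ξ : E =>
        Complex.exp (-t * ‖ξ‖ ^ 2 + 2 * Real.pi * Complex.I * inner ℝ x ξ)) y * g y := by
    simpa using! (VectorFourier.integral_fourierIntegral_smul_eq_flip (L := innerₗ E)
      Real.continuous_fourierChar continuous_inner hJ hg).symm
  rw [hflip]
  refine (enorm_integral_le_lintegral_enorm _).trans (lintegral_mono fun y => ?_)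
  rw [fourier_gaussian_innerProductSpace' ht', enorm_mul]
  gcongr
  have h₁ : ((Real.pi : ℂ) / t) ^ (Module.finrank ℝ E / 2 : ℂ)
      = (((Real.pi / t) ^ (Module.finrank ℝ E / 2 : ℝ) : ℝ) : ℂ) := by
    rw [Complex.ofReal_cpow (by positivity)]; push_cast; rfl
  have h₂ : Complex.exp (-(Real.pi : ℂ) ^ 2 * (‖x - y‖ : ℂ) ^ 2 / t)
      = ((Real.exp (-(Real.pi ^ 2 * ‖x - y‖ ^ 2 / t)) : ℝ) : ℂ) := by
    push_cast; congr 1; ring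
  rw [h₁, h₂, ← Complex.ofReal_mul, ← ofReal_norm, Complex.norm_of_nonneg (by positivity)]

/-- If `𝓕 g = ‖ξ‖ ^ α 𝓕 f`, then `f` is pointwise dominated by the Riesz potential of `‖g‖`. -/
theorem enorm_le_lintegral_riesz [Nontrivial E] {α : ℝ} (hα : 0 < α)
    (hαd : α < Module.finrank ℝ E) {f g : E → ℂ} (hfc : Continuous f) (hf : Integrable f)
    (hFf : Integrable (𝓕 f)) (hg : Integrable g)
    (hfg : ∀ ξ, 𝓕 g ξ = (‖ξ‖ : ℂ) ^ (α : ℂ) * 𝓕 f ξ) (x : E) :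
    ENNReal.ofReal (Real.Gamma (α / 2)) * ‖f x‖ₑ
      ≤ ENNReal.ofReal (Real.pi ^ (Module.finrank ℝ E / 2 : ℝ)
          * (1 / Real.pi ^ 2) ^ ((Module.finrank ℝ E - α) / 2)
          * Real.Gamma ((Module.finrank ℝ E - α) / 2))
        * ∫⁻ y, ENNReal.ofReal (‖x - y‖ ^ (α - Module.finrank ℝ E)) * ‖g y‖ₑ := by
  set d : ℝ := (Module.finrank ℝ E : ℝ) with hd
  set e : ℝ → E → ℂ := fun t ξ =>
    Complex.exp (-t * ‖ξ‖ ^ 2 + 2 * Real.pi * Complex.I * inner ℝ x ξ) with he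
  set H : E → ℝ → ℂ := fun ξ t => ((t ^ (α / 2 - 1) : ℝ) : ℂ) * (e t ξ * 𝓕 g ξ) with hH
  have hae : ∀ᵐ ξ : E, ξ ≠ 0 := by simp [ae_iff]
  have hmul (ξ : E) : 𝓕 g ξ = ((‖ξ‖ ^ α : ℝ) : ℂ) * 𝓕 f ξ := by
    rw [hfg, Complex.ofReal_cpow (norm_nonneg _)]
  have hsplit (ξ : E) (t : ℝ) : H ξ t = ((t ^ (α / 2 - 1) * Real.exp (-(‖ξ‖ ^ 2 * t)) : ℝ) : ℂ)
      * (Complex.exp (2 * Real.pi * Complex.I * inner ℝ x ξ) * 𝓕 g ξ) := by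
    simp only [hH, he, Complex.exp_add]
    push_cast
    rw [show -(t : ℂ) * ‖ξ‖ ^ 2 = -(‖ξ‖ ^ 2 * t) by ring]
    ring
  have hexp (ξ : E) : ‖Complex.exp (2 * Real.pi * Complex.I * inner ℝ x ξ)‖ = 1 := by
    rw [show 2 * (Real.pi : ℂ) * Complex.I * inner ℝ x ξ
      = ((2 * Real.pi * inner ℝ x ξ : ℝ) : ℂ) * Complex.I by push_cast; ring]
    exact Complex.norm_exp_ofReal_mul_I _
  have hpow {ξ : E} (hξ : ξ ≠ 0) : (1 / ‖ξ‖ ^ 2) ^ (α / 2) * ‖ξ‖ ^ α = 1 := by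
    have h0 : 0 < ‖ξ‖ := norm_pos_iff.mpr hξ
    rw [Real.div_rpow (by norm_num) (by positivity), Real.one_rpow, ← Real.rpow_natCast,
      ← Real.rpow_mul h0.le]
    rw [show ((2 : ℕ) : ℝ) * (α / 2) = α by push_cast; ring, one_div_mul_cancel (by positivity)]
  have hgauss {ξ : E} (hξ : ξ ≠ 0) :=
    Real.integral_rpow_mul_exp_neg_mul_Ioi (half_pos hα) (r := ‖ξ‖ ^ 2)
      (by have := norm_pos_iff.mpr hξ; positivity)
  have hgaussi {ξ : E} (hξ : ξ ≠ 0) : IntegrableOn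
      (fun t : ℝ => t ^ (α / 2 - 1) * Real.exp (-(‖ξ‖ ^ 2 * t))) (Set.Ioi 0) := by
    refine not_imp_comm.1 integral_undef ?_
    have := norm_pos_iff.mpr hξ
    rw [hgauss hξ]
    positivity
  have hFg : AEStronglyMeasurable (𝓕 g) volume := by
    rw [funext hmul]
    exact (by fun_prop : Measurable fun ξ : E =>
      ((‖ξ‖ ^ α : ℝ) : ℂ)).aestronglyMeasurable.mul hFf.aestronglyMeasurable
  have hHm : AEStronglyMeasurable (Function.uncurry H)
      ((volume : Measure E).prod (volume.restrict (Set.Ioi (0 : ℝ)))) := by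
    have h1 : Measurable fun z : E × ℝ => ((z.2 ^ (α / 2 - 1) : ℝ) : ℂ) := by fun_prop
    have h2 : Measurable fun z : E × ℝ => e z.2 z.1 := by
      refine Continuous.measurable ?_
      simp only [he]
      fun_prop
    exact h1.aestronglyMeasurable.mul (h2.aestronglyMeasurable.mul hFg.comp_fst)
  have hHi : Integrable (Function.uncurry H)
      ((volume : Measure E).prod (volume.restrict (Set.Ioi (0 : ℝ)))) := by
    rw [integrable_prod_iff hHm]
    constructor
    · filter_upwards [hae] with ξ hξ
      simp only [Function.uncurry_apply_pair, hsplit]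
      exact (hgaussi hξ).ofReal.mul_const _
    · refine (hFf.norm.const_mul (Real.Gamma (α / 2))).congr ?_
      filter_upwards [hae] with ξ hξ
      have : ∫ t in Set.Ioi (0 : ℝ), ‖H ξ t‖
          = ∫ t in Set.Ioi (0 : ℝ), (t ^ (α / 2 - 1) * Real.exp (-(‖ξ‖ ^ 2 * t))) * ‖𝓕 g ξ‖ := by
        refine setIntegral_congr_fun measurableSet_Ioi fun t ht => ?_
        have ht : 0 < t := ht
        simp only [hsplit]
        rw [norm_mul, norm_mul, hexp, one_mul, Complex.norm_of_nonneg (by positivity)]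
      simp only [Function.uncurry_apply_pair]
      rw [this, integral_mul_const, hgauss hξ, hmul, norm_mul,
        Complex.norm_of_nonneg (by positivity)]
      linear_combination (-(Real.Gamma (α / 2) * ‖𝓕 f ξ‖)) * hpow hξ
  have hrep : (Real.Gamma (α / 2) : ℂ) * f x = ∫ ξ, ∫ t in Set.Ioi (0 : ℝ), H ξ t := by
    rw [← congrFun (hfc.fourierInv_fourier_eq hf hFf) x, Real.fourierInv_eq', ← integral_const_mul]
    refine integral_congr_ae ?_
    filter_upwards [hae] with ξ hξ
    simp only [hsplit]
    rw [integral_mul_const, integral_complex_ofReal, hgauss hξ, hmul, smul_eq_mul]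
    have h := congrArg (fun r : ℝ => (r : ℂ)) (hpow hξ)
    simp only [Complex.ofReal_mul, Complex.ofReal_one] at h
    rw [show ((2 * Real.pi * inner ℝ ξ x : ℝ) : ℂ) * Complex.I
      = 2 * Real.pi * Complex.I * inner ℝ x ξ by rw [real_inner_comm]; push_cast; ring]
    push_cast at h ⊢
    linear_combination (-(Real.Gamma (α / 2) : ℂ)
      * Complex.exp (2 * Real.pi * Complex.I * inner ℝ x ξ) * 𝓕 f ξ) * h
  rw [integral_integral_swap hHi] at hrep
  calc ENNReal.ofReal (Real.Gamma (α / 2)) * ‖f x‖ₑ = ‖(Real.Gamma (α / 2) : ℂ) * f x‖ₑ := by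
        rw [enorm_mul, ← ofReal_norm (Real.Gamma (α / 2) : ℂ),
          Complex.norm_of_nonneg (by positivity)]
    _ ≤ ∫⁻ t in Set.Ioi (0 : ℝ), ‖∫ ξ, H ξ t‖ₑ := by
        rw [hrep]; exact enorm_integral_le_lintegral_enorm _
    _ ≤ ∫⁻ t in Set.Ioi (0 : ℝ), ∫⁻ y, ENNReal.ofReal (Real.pi ^ (d / 2)
          * (t ^ (-((d - α) / 2) - 1) * Real.exp (-(Real.pi ^ 2 * ‖x - y‖ ^ 2 / t)))) * ‖g y‖ₑ := by
        refine setLIntegral_mono' measurableSet_Ioi fun t ht => ?_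
        have ht : 0 < t := ht
        simp only [hH]
        rw [integral_const_mul, enorm_mul, ← ofReal_norm ((t ^ (α / 2 - 1) : ℝ) : ℂ),
          Complex.norm_of_nonneg (by positivity)]
        refine (mul_le_mul_right (enorm_integral_gaussian_mul_fourier_le hg ht x) _).trans ?_
        rw [← lintegral_const_mul' _ _ ENNReal.ofReal_ne_top]
        refine lintegral_mono fun y => le_of_eq ?_
        rw [← mul_assoc, ← ENNReal.ofReal_mul (by positivity)]
        congr 2
        rw [Real.div_rpow (by positivity) ht.le, div_eq_mul_inv (Real.pi ^ _), ← Real.rpow_neg ht.le,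
          show -((d - α) / 2) - 1 = (α / 2 - 1) + -(d / 2) by ring, Real.rpow_add ht]
        ring
    _ = ∫⁻ y, ∫⁻ t in Set.Ioi (0 : ℝ), ENNReal.ofReal (Real.pi ^ (d / 2)
          * (t ^ (-((d - α) / 2) - 1) * Real.exp (-(Real.pi ^ 2 * ‖x - y‖ ^ 2 / t)))) * ‖g y‖ₑ := by
        refine lintegral_lintegral_swap ?_
        refine AEMeasurable.mul (f := fun z : ℝ × E => ENNReal.ofReal (Real.pi ^ (d / 2)
          * (z.1 ^ (-((d - α) / 2) - 1) * Real.exp (-(Real.pi ^ 2 * ‖x - z.2‖ ^ 2 / z.1)))))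
          (by fun_prop) (hg.aestronglyMeasurable.enorm.comp_snd)
    _ = ∫⁻ y, ENNReal.ofReal (Real.pi ^ (d / 2) * (1 / Real.pi ^ 2) ^ ((d - α) / 2)
          * Real.Gamma ((d - α) / 2)) * (ENNReal.ofReal (‖x - y‖ ^ (α - d)) * ‖g y‖ₑ) := by
        have hne : ∀ᵐ y : E, y ≠ x := by simp [ae_iff]
        refine lintegral_congr_ae ?_
        filter_upwards [hne] with y hy
        have hr : 0 < ‖x - y‖ := norm_pos_iff.mpr (sub_ne_zero.mpr hy.symm)
        have hs : 0 < (d - α) / 2 := by linarith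
        have hπ : (0 : ℝ) ≤ Real.pi ^ (d / 2) := by positivity
        have hscale : (1 / (Real.pi ^ 2 * ‖x - y‖ ^ 2)) ^ ((d - α) / 2)
            = (1 / Real.pi ^ 2) ^ ((d - α) / 2) * ‖x - y‖ ^ (α - d) := by
          rw [← one_div_mul_one_div, Real.mul_rpow (by positivity) (by positivity),
            one_div (‖x - y‖ ^ 2), Real.inv_rpow (by positivity), ← Real.rpow_natCast ‖x - y‖,
            ← Real.rpow_mul hr.le, ← Real.rpow_neg hr.le]
          congr 2
          push_cast
          ring
        simp only [ENNReal.ofReal_mul hπ]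
        rw [lintegral_mul_const _ (by fun_prop), lintegral_const_mul _ (by fun_prop),
          lintegral_rpow_mul_exp_neg_div_Ioi hs (by positivity), hscale, ← mul_assoc,
          ← ENNReal.ofReal_mul hπ, ← ENNReal.ofReal_mul (by positivity)]
        congr 2
        ring
    _ = _ := lintegral_const_mul' _ _ ENNReal.ofReal_ne_top

end Riesz

/-- The Stein–Weiss inequality `‖|x|^{-α} I_α G‖_p ≲ ‖G‖_p` for `0 < α < d / p`. -/
theorem exists_lintegral_rpow_norm_rpow_mul_riesz_le {E : Type*} [NormedAddCommGroup E]
    [InnerProductSpace ℝ E] [FiniteDimensional ℝ E] [MeasurableSpace E] [BorelSpace E]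
    [Nontrivial E] {p α : ℝ} (hp : 1 < p) (hα0 : 0 < α) (hα : α < Module.finrank ℝ E / p) :
    ∃ D : ℝ≥0∞, D ≠ ∞ ∧ ∀ G : E → ℝ≥0∞, Measurable G →
      ∫⁻ x, (ENNReal.ofReal (‖x‖ ^ (-α))
          * ∫⁻ y, ENNReal.ofReal (‖x - y‖ ^ (α - Module.finrank ℝ E)) * G y) ^ p
        ≤ D * ∫⁻ y, G y ^ p := by
  set d : ℝ := (Module.finrank ℝ E : ℝ) with hd
  have hp0 : 0 < p := by linarith
  have hp1 : 0 < p - 1 := by linarith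
  have hαp : α * p < d := (lt_div_iff₀ hp0).mp hα
  obtain ⟨a, haα, ha⟩ : ∃ a, α < a ∧ a < min d ((d - α) / (p - 1)) := by
    refine exists_between (lt_min ?_ ?_)
    · nlinarith
    · rw [lt_div_iff₀ hp1]; linarith
  have had : a < d := ha.trans_le (min_le_left _ _)
  have hab : α + a * (p - 1) < d := by
    have := (lt_div_iff₀ hp1).mp (ha.trans_le (min_le_right _ _))
    linarith
  have ha0 : 0 < a := hα0.trans haα
  have hpq : p.HolderConjugate p.conjExponent := Real.HolderConjugate.conjExponent hp
  set q := p.conjExponent with hq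
  have hq0 : 0 < q := hpq.symm.pos
  obtain ⟨A, hAt, hA⟩ := exists_lintegral_riesz_mul_norm_rpow_le (E := E) hα0 haα had
  obtain ⟨B, hBt, hB⟩ := exists_lintegral_riesz_mul_norm_rpow_le (E := E) hα0
    (b := α + a * (p - 1)) (by nlinarith) hab
  rw [← hd] at hA hB
  have hae : ∀ᵐ x : E, x ≠ 0 := by simp [ae_iff]
  set w : E → ℝ≥0∞ := fun x => ENNReal.ofReal (‖x‖ ^ (-(a / q))) with hw
  have hwq (x : E) : w x ^ q = ENNReal.ofReal (‖x‖ ^ (-a)) := by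
    rw [hw, ENNReal.ofReal_rpow_of_nonneg (by positivity) hq0.le, ← Real.rpow_mul (norm_nonneg _)]
    congr 2
    field_simp
  have hwp (x : E) : w x ^ p = ENNReal.ofReal (‖x‖ ^ (-(a * (p - 1)))) := by
    rw [hw, ENNReal.ofReal_rpow_of_nonneg (by positivity) hp0.le, ← Real.rpow_mul (norm_nonneg _)]
    congr 2
    rw [hq, Real.conjExponent]
    field_simp
  refine ⟨A ^ (p / q) * B, ENNReal.mul_ne_top (ENNReal.rpow_ne_top_of_nonneg (by positivity) hAt)
    hBt, fun G hG => ?_⟩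
  have schur := lintegral_rpow_lintegral_mul_le_of_schur (μ := (volume : Measure E)) hpq
    (K := fun x y => ENNReal.ofReal (‖x‖ ^ (-α)) * ENNReal.ofReal (‖x - y‖ ^ (α - d)))
    (by unfold Function.uncurry; fun_prop) (w := w) (by fun_prop) hG (A := A) (B := B)
    ?_ (.of_forall fun x => ENNReal.ofReal_ne_top) ?_ ?_
  · refine le_trans (le_of_eq (lintegral_congr fun x => ?_)) schur
    simp only [mul_assoc]
    rw [lintegral_const_mul _ (by fun_prop)]
  · filter_upwards [hae] with x hx
    have := norm_pos_iff.mpr hx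
    simp only [hw, ne_eq, ENNReal.ofReal_eq_zero, not_le]
    positivity
  · filter_upwards [hae] with x hx
    have hx' := norm_pos_iff.mpr hx
    simp only [hwq, mul_assoc]
    rw [lintegral_const_mul _ (by fun_prop)]
    refine (mul_le_mul_right (hA x hx) _).trans (le_of_eq ?_)
    rw [mul_left_comm, ← ENNReal.ofReal_mul (by positivity), ← Real.rpow_add hx']
    congr 3
    ring
  · filter_upwards [hae] with y hy
    refine le_trans (le_of_eq (lintegral_congr_ae ?_)) ((hB y hy).trans (le_of_eq ?_))
    · filter_upwards [hae] with x hx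
      rw [hwp, norm_sub_rev x y, mul_comm (ENNReal.ofReal (‖x‖ ^ (-α))), mul_assoc,
        ← ENNReal.ofReal_mul (by positivity), ← Real.rpow_add (norm_pos_iff.mpr hx)]
      congr 3
      ring
    · rw [hwp]
      congr 3
      ring

/-- A non-integrable `g` has zero Fourier integral by convention, which forces `f = 0`. -/
theorem eq_zero_of_fourier_multiplier_of_not_integrable {E : Type*} [NormedAddCommGroup E]
    [InnerProductSpace ℝ E] [FiniteDimensional ℝ E] [MeasurableSpace E] [BorelSpace E]
    [Nontrivial E] {α : ℂ} {f g : E → ℂ} (hfc : Continuous f) (hf : Integrable f)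
    (hFf : Integrable (𝓕 f)) (hg : ¬ Integrable g)
    (hfg : ∀ ξ, 𝓕 g ξ = (‖ξ‖ : ℂ) ^ α * 𝓕 f ξ) : f = 0 := by
  have hFg (ξ : E) : 𝓕 g ξ = 0 := by
    rw [Real.fourier_eq]
    exact integral_undef fun h => hg ((Real.fourierIntegral_convergent_iff ξ).mp h)
  have hae : ∀ᵐ ξ : E, 𝓕 f ξ = (0 : E → ℂ) ξ := by
    have hne : ∀ᵐ ξ : E, ξ ≠ 0 := by simp [ae_iff]
    filter_upwards [hne] with ξ hξ
    have h := (hfg ξ).symm.trans (hFg ξ)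
    simpa [Complex.cpow_eq_zero_iff, hξ] using h
  funext x
  rw [← congrFun (hfc.fourierInv_fourier_eq hf hFf) x, Real.fourierInv_congr_ae hae,
    Real.fourierInv_eq]
  simp

theorem fractional_hardy (n : ℕ) (hn : 1 ≤ n) (p α : ℝ) (hp : 1 < p)
    (hα0 : 0 < α) (hα : α < (n : ℝ) / p) :
    ∃ C : ℝ, 0 < C ∧ ∀ f g : EuclideanSpace ℝ (Fin n) → ℂ,
      ContDiff ℝ (⊤ : ℕ∞) f → HasCompactSupport f →
      (∀ ξ, 𝓕 g ξ = (‖ξ‖ : ℂ) ^ (α : ℂ) * 𝓕 f ξ) →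
        eLpNorm (fun x => ‖x‖ ^ (-α) * ‖f x‖) (ENNReal.ofReal p) volume
          ≤ ENNReal.ofReal C * eLpNorm g (ENNReal.ofReal p) volume := by
  have : Nonempty (Fin n) := ⟨⟨0, hn⟩⟩
  have hp0 : 0 < p := by linarith
  have hfin : (Module.finrank ℝ (EuclideanSpace ℝ (Fin n)) : ℝ) = n := by simp
  have hαn : α < n := hα.trans_le (div_le_self (by positivity) hp.le)
  obtain ⟨D, hDt, hD⟩ := exists_lintegral_rpow_norm_rpow_mul_riesz_le
    (E := EuclideanSpace ℝ (Fin n)) hp hα0 (by rwa [hfin])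
  set Γ₀ := ENNReal.ofReal (Real.Gamma (α / 2)) with hΓ₀
  have hΓpos : Γ₀ ≠ 0 := by
    have : 0 < Real.Gamma (α / 2) := Real.Gamma_pos_of_pos (by positivity)
    simpa [hΓ₀] using this
  set M := ENNReal.ofReal (Real.pi ^ (Module.finrank ℝ (EuclideanSpace ℝ (Fin n)) / 2 : ℝ)
          * (1 / Real.pi ^ 2) ^ ((Module.finrank ℝ (EuclideanSpace ℝ (Fin n)) - α) / 2)
          * Real.Gamma ((Module.finrank ℝ (EuclideanSpace ℝ (Fin n)) - α) / 2)) with hM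
  set c := M / Γ₀ with hc
  have hct : c ≠ ∞ := ENNReal.div_ne_top ENNReal.ofReal_ne_top hΓpos
  have hcD : c * D ^ (1 / p) ≠ ∞ :=
    ENNReal.mul_ne_top hct (ENNReal.rpow_ne_top_of_nonneg (by positivity) hDt)
  refine ⟨(c * D ^ (1 / p)).toReal + 1, by positivity, fun f g hf hfs hfg => ?_⟩
  have hfi : Integrable f := hf.continuous.integrable_of_hasCompactSupport hfs
  have hFf : Integrable (𝓕 f) := (𝓕 (hfs.toSchwartzMap hf)).integrable
  by_cases hg : Integrable g
  swap
  · simp [eq_zero_of_fourier_multiplier_of_not_integrable hf.continuous hfi hFf hg hfg]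
  have hC : c * D ^ (1 / p) ≤ ENNReal.ofReal ((c * D ^ (1 / p)).toReal + 1) :=
    (ENNReal.ofReal_toReal hcD).symm.le.trans (ENNReal.ofReal_le_ofReal (by linarith))
  refine le_trans ?_ (mul_le_mul_left hC _)
  have hpne : ENNReal.ofReal p ≠ 0 := by simpa using hp0
  rw [eLpNorm_eq_lintegral_rpow_enorm_toReal hpne ENNReal.ofReal_ne_top,
    eLpNorm_eq_lintegral_rpow_enorm_toReal hpne ENNReal.ofReal_ne_top,
    ENNReal.toReal_ofReal hp0.le]
  have hgm : AEMeasurable (fun y => ‖g y‖ₑ) := hg.aestronglyMeasurable.enorm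
  have hbound (x : EuclideanSpace ℝ (Fin n)) : ‖‖x‖ ^ (-α) * ‖f x‖‖ₑ
      ≤ c * (ENNReal.ofReal (‖x‖ ^ (-α)) * ∫⁻ y, ENNReal.ofReal
        (‖x - y‖ ^ (α - Module.finrank ℝ (EuclideanSpace ℝ (Fin n)))) * hgm.mk _ y) := by
    have h := enorm_le_lintegral_riesz hα0 (by rwa [hfin]) hf.continuous hfi hFf hg hfg x
    rw [mul_comm, ← hΓ₀, ← ENNReal.le_div_iff_mul_le (.inl hΓpos) (.inl ENNReal.ofReal_ne_top),
      ← hM, ENNReal.mul_div_right_comm, ← hc] at h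
    have hcongr : ∫⁻ y, ENNReal.ofReal
        (‖x - y‖ ^ (α - Module.finrank ℝ (EuclideanSpace ℝ (Fin n)))) * ‖g y‖ₑ
        = ∫⁻ y, ENNReal.ofReal
        (‖x - y‖ ^ (α - Module.finrank ℝ (EuclideanSpace ℝ (Fin n)))) * hgm.mk _ y := by
      refine lintegral_congr_ae ?_
      filter_upwards [hgm.ae_eq_mk] with y hy
      rw [← hy]
    rw [enorm_mul, enorm_norm, Real.enorm_of_nonneg (by positivity), mul_left_comm, ← hcongr]
    gcongr
  calc _ ≤ (c ^ p * (D * ∫⁻ y, hgm.mk _ y ^ p)) ^ (1 / p) := by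
        gcongr
        refine le_trans ?_ (mul_le_mul_right (hD _ hgm.measurable_mk) _)
        rw [← lintegral_const_mul' _ _ (ENNReal.rpow_ne_top_of_nonneg hp0.le hct)]
        refine lintegral_mono fun x => ?_
        rw [← ENNReal.mul_rpow_of_nonneg _ _ hp0.le]
        gcongr
        exact hbound x
    _ = _ := by
        have hnorm : ∫⁻ y, hgm.mk _ y ^ p = ∫⁻ y, ‖g y‖ₑ ^ p := by
          refine lintegral_congr_ae ?_
          filter_upwards [hgm.ae_eq_mk] with y hy
          rw [← hy]
        rw [hnorm, ENNReal.mul_rpow_of_nonneg _ _ (by positivity),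
          ENNReal.mul_rpow_of_nonneg _ _ (by positivity), ← ENNReal.rpow_mul,
          mul_one_div_cancel hp0.ne', ENNReal.rpow_one, mul_assoc]
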